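/- Let A₁, A₂, Φ : ℝ² → ℝ³ be continuously differentiable and let A₀ : ℝ² → ℝ³ be a twice continuously differentiable solution on ℝ² of ΔA₀ + ∂_i(A_i × A₀) + A_i × ∂_iA₀ + A_i × (A_i × A₀) − Φ × (A₀ × Φ) = 0 with E(A₀) = ∫_{ℝ²} [ ½ Σ_i |∂_iA₀ + A_i × A₀|² + ½ |A₀ × Φ|² ] dx < ∞. Then for every M > 0 and every R > 1, ∫_{{|A₀| ≤ M} ∩ B_R} [ Σ_i |∂_iA₀ + A_i × A₀|² + |A₀ × Φ|² ] dx ≤ M (4π E(A₀) / log R)^{1/2}, where B_R is the disk of radius R centered at the origin. -/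

import Mathlib

/-!
The truncation/logarithmic-cutoff estimate in the proof of the non-Abelian
Julia–Zee theorem (inequality (4.4) of Spruck–Yang).
-/

open MeasureTheory

noncomputable section

/-- The plane ℝ². -/
abbrev Plane : Type := EuclideanSpace ℝ (Fin 2)

/-- Euclidean ℝ³. -/
abbrev V3 : Type := EuclideanSpace ℝ (Fin 3)

/-- The vector cross product on ℝ³. -/
def cross (a b : V3) : V3 :=
  (WithLp.equiv 2 (Fin 3 → ℝ)).symm
    ![a 1 * b 2 - a 2 * b 1, a 2 * b 0 - a 0 * b 2, a 0 * b 1 - a 1 * b 0]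

/-- Partial derivative of an ℝ³-valued field in the `i`-th coordinate direction. -/
def pd (i : Fin 2) (f : Plane → V3) (x : Plane) : V3 :=
  fderiv ℝ f x (EuclideanSpace.single i 1)

/-- The (componentwise) Laplacian on ℝ². -/
def lap (f : Plane → V3) (x : Plane) : V3 :=
  pd 0 (pd 0 f) x + pd 1 (pd 1 f) x

/-- A `C¹` substitute for the truncation factor `t ↦ min 1 √(m / t)` in the variable
`t = |A₀|²`. -/
theorem exists_truncation_factor {m δ : ℝ} (hm : 0 < m) (hδ : 0 < δ) :
    ∃ F F' : ℝ → ℝ, (∀ t, HasDerivAt F (F' t) t) ∧ Continuous F' ∧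
      (∀ t ≤ m, F t = 1 ∧ F' t = 0) ∧
      ∀ t, 0 ≤ t → 0 ≤ F t ∧ F' t ≤ 0 ∧ 0 ≤ F t + 2 * t * F' t ∧ t * F t ^ 2 ≤ m + δ := by
  set u : ℝ → ℝ := fun t => max (t - m) 0 with hu
  have hu0 : ∀ t, 0 ≤ u t := fun t => le_max_right _ _
  have huc : Continuous u := by fun_prop
  have hud : ∀ t, u t + δ ≠ 0 := fun t => by linarith [hu0 t]
  set q : ℝ → ℝ := fun t => (u t - δ + δ ^ 2 / (u t + δ)) / (m + δ) with hq
  set q' : ℝ → ℝ := fun t => (1 - δ ^ 2 / (u t + δ) ^ 2) / (m + δ) with hq'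
  have hqc : Continuous q :=
    ((huc.sub continuous_const).add
      (continuous_const.div (huc.add continuous_const) hud)).div_const _
  have hq'c : Continuous q' :=
    (continuous_const.sub (continuous_const.div ((huc.add continuous_const).pow 2)
      fun t => pow_ne_zero 2 (hud t))).div_const _
  have hlow : ∀ t ≤ m, u t = 0 := fun t ht => max_eq_right (by linarith)
  have hhigh : ∀ t, m ≤ t → u t = t - m := fun t ht => max_eq_left (by linarith)
  have hqd : ∀ t, HasDerivAt q (q' t) t := by
    refine hasDerivAt_of_hasDerivAt_of_ne' (x := m) (fun t ht => ?_) hqc.continuousAt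
      hq'c.continuousAt
    rcases lt_or_gt_of_ne ht with h | h
    · have h0 : q' t = 0 := by
        simp only [hq', hlow t h.le]
        field_simp
        simp
      rw [h0]
      refine (hasDerivAt_const t (q t)).congr_of_eventuallyEq ?_
      filter_upwards [Iio_mem_nhds h] with s hs
      simp only [hq, hlow t h.le, hlow s (le_of_lt hs)]
    · have hne : t - m + δ ≠ 0 := by linarith
      have h1 : HasDerivAt (fun s : ℝ => s - m + δ) 1 t :=
        ((hasDerivAt_id t).sub_const m).add_const δ
      have h2 := ((((hasDerivAt_id t).sub_const m).sub_const δ).add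
        ((h1.inv hne).const_mul (δ ^ 2))).div_const (m + δ)
      have h3 : q' t = (1 + δ ^ 2 * (-1 / (t - m + δ) ^ 2)) / (m + δ) := by
        simp only [hq', hhigh t h.le]
        ring
      rw [h3]
      refine h2.congr_of_eventuallyEq ?_
      filter_upwards [Ioi_mem_nhds h] with s hs
      simp only [hq, hhigh s (le_of_lt hs), Pi.add_apply, Pi.inv_apply, id]
      ring
  have hqn : ∀ t, 0 ≤ q t := fun t => by
    have h := hu0 t
    have : q t = u t ^ 2 / ((u t + δ) * (m + δ)) := by
      simp only [hq]
      field_simp [hud t]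
      ring
    rw [this]
    positivity
  have hq'n : ∀ t, 0 ≤ q' t := fun t => by
    have h := hu0 t
    have : q' t = (u t ^ 2 + 2 * u t * δ) / ((u t + δ) ^ 2 * (m + δ)) := by
      simp only [hq']
      field_simp [hud t]
      ring
    rw [this]
    positivity
  set s : ℝ → ℝ := fun t => √(1 + q t) with hs
  have hs0 : ∀ t, 0 < s t := fun t => Real.sqrt_pos.2 (by linarith [hqn t])
  have hs2 : ∀ t, s t ^ 2 = 1 + q t := fun t => Real.sq_sqrt (by linarith [hqn t])
  have hsc : Continuous s := (continuous_const.add hqc).sqrt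
  refine ⟨fun t => (s t)⁻¹, fun t => -(q' t / (2 * s t)) / s t ^ 2, fun t => ?_, ?_, ?_, ?_⟩
  · exact (((hqd t).const_add 1).sqrt (by linarith [hqn t])).inv (hs0 t).ne'
  · exact ((hq'c.div (continuous_const.mul hsc) fun t =>
      (mul_pos two_pos (hs0 t)).ne').neg).div
      (hsc.pow 2) fun t => pow_ne_zero 2 (hs0 t).ne'
  · intro t ht
    have h0 : q t = 0 := by
      simp only [hq, hlow t ht]
      field_simp
      ring
    have h1 : q' t = 0 := by
      simp only [hq', hlow t ht]
      field_simp
      simp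
    simp [hs, h0, h1]
  · intro t ht
    have hst := hs0 t
    have hq't := hq'n t
    have hut := hu0 t
    have htu : t ≤ m + u t := by linarith [le_max_left (t - m) 0]
    have key : 0 ≤ 1 + q t - t * q' t := by
      have h1 : t * q' t ≤ (m + u t) * q' t := mul_le_mul_of_nonneg_right htu hq't
      have h2 : 1 + q t - (m + u t) * q' t =
          (m * δ ^ 2 + 2 * u t * δ ^ 2 + δ ^ 3) / ((u t + δ) ^ 2 * (m + δ)) := by
        simp only [hq, hq']
        field_simp [hud t]
        ring
      have h3 : 0 ≤ 1 + q t - (m + u t) * q' t := by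
        rw [h2]
        positivity
      linarith
    refine ⟨by positivity, ?_, ?_, ?_⟩
    · exact div_nonpos_of_nonpos_of_nonneg (neg_nonpos.2 (by positivity)) (by positivity)
    · have : (s t)⁻¹ + 2 * t * (-(q' t / (2 * s t)) / s t ^ 2) =
          (1 + q t - t * q' t) / s t ^ 3 := by
        rw [← hs2]
        field_simp
        ring
      rw [this]
      positivity
    · rw [inv_pow, hs2, ← div_eq_mul_inv, div_le_iff₀ (by linarith [hqn t])]
      have : (m + δ) * (1 + q t) = m + u t + δ ^ 2 / (u t + δ) := by
        simp only [hq]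
        field_simp
        ring
      rw [this]
      have : 0 ≤ δ ^ 2 / (u t + δ) := by positivity
      linarith

/-- The radial profile of the logarithmic cutoff: `1` for `r ≤ R`, `2 - log r / log R` for
`R ≤ r ≤ R²`, and `0` for `r ≥ R²`. -/
def logCutoff (R r : ℝ) : ℝ := max 0 (min 1 (2 - Real.log (max r R) / Real.log R))

theorem logCutoff_nonneg (R r : ℝ) : 0 ≤ logCutoff R r := le_max_left _ _

theorem logCutoff_of_le {R r : ℝ} (hR : 1 < R) (hr : r ≤ R) : logCutoff R r = 1 := by
  have := Real.log_pos hR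
  rw [logCutoff, max_eq_right hr, div_self this.ne']
  norm_num

theorem logCutoff_of_mem {R r : ℝ} (hR : 1 < R) (h1 : R ≤ r) (h2 : r ≤ R ^ 2) :
    logCutoff R r = 2 - Real.log r / Real.log R := by
  have hl := Real.log_pos hR
  have h3 : 1 ≤ Real.log r / Real.log R := by
    rw [one_le_div hl]
    exact Real.log_le_log (by linarith) h1
  have h4 : Real.log r / Real.log R ≤ 2 := by
    rw [div_le_iff₀ hl]
    calc Real.log r ≤ Real.log (R ^ 2) := Real.log_le_log (by linarith) h2
      _ = 2 * Real.log R := by simp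
  rw [logCutoff, max_eq_left h1, min_eq_right (by linarith), max_eq_right (by linarith)]

theorem logCutoff_of_ge {R r : ℝ} (hR : 1 < R) (hr : R ^ 2 ≤ r) : logCutoff R r = 0 := by
  have hl := Real.log_pos hR
  have h1 : R ≤ r := by nlinarith
  have h3 : 2 ≤ Real.log r / Real.log R := by
    rw [le_div_iff₀ hl]
    calc 2 * Real.log R = Real.log (R ^ 2) := by simp
      _ ≤ Real.log r := Real.log_le_log (by positivity) hr
  rw [logCutoff, max_eq_left h1]
  exact max_eq_left ((min_le_right _ _).trans (by linarith))

theorem log_max_lipschitz {R : ℝ} (hR : 1 < R) :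
    LipschitzWith 1 fun r : ℝ => Real.log (max r R) := by
  refine LipschitzWith.of_le_add fun x y => ?_
  have hx : 0 < max x R := lt_max_of_lt_right (by linarith)
  have hy : 1 < max y R := lt_max_of_lt_right hR
  have h1 : Real.log (max x R) - Real.log (max y R) ≤ max x R / max y R - 1 := by
    rw [← Real.log_div hx.ne' (by linarith)]
    exact Real.log_le_sub_one_of_pos (by positivity)
  have h2 : max x R ≤ max y R + dist x y := by
    have := abs_max_sub_max_le_abs x y R
    rw [Real.dist_eq]
    linarith [le_abs_self (max x R - max y R)]
  have h3 : max x R / max y R - 1 ≤ dist x y := by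
    rw [div_sub_one (by linarith), div_le_iff₀ (by linarith)]
    nlinarith [dist_nonneg (x := x) (y := y)]
  linarith

theorem logCutoff_norm_lipschitz {E : Type*} [NormedAddCommGroup E] {R : ℝ} (hR : 1 < R) :
    ∃ C, LipschitzWith C fun x : E => logCutoff R ‖x‖ := by
  have hl := Real.log_pos hR
  have h1 : LipschitzWith (1 / Real.log R).toNNReal
      fun r : ℝ => 2 - Real.log (max r R) / Real.log R := by
    refine LipschitzWith.of_dist_le_mul fun x y => ?_
    have := (log_max_lipschitz hR).dist_le_mul x y
    rw [Real.coe_toNNReal _ (by positivity), Real.dist_eq]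
    rw [Real.dist_eq, NNReal.coe_one, one_mul] at this
    have h2 : 2 - Real.log (max x R) / Real.log R - (2 - Real.log (max y R) / Real.log R) =
        -((Real.log (max x R) - Real.log (max y R)) / Real.log R) := by ring
    rw [h2, abs_neg, abs_div, abs_of_pos hl, one_div, inv_mul_eq_div]
    gcongr
  exact ⟨_, ((h1.const_min 1).const_max 0).comp lipschitzWith_one_norm⟩

theorem hasCompactSupport_logCutoff_norm {E : Type*} [NormedAddCommGroup E] [ProperSpace E]
    {R : ℝ} (hR : 1 < R) : HasCompactSupport fun x : E => logCutoff R ‖x‖ :=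
  HasCompactSupport.intro (isCompact_closedBall (0 : E) (R ^ 2)) fun x hx =>
    logCutoff_of_ge hR (by simpa using (not_le.1 (by simpa using hx) : R ^ 2 < ‖x‖).le)

/-- The derivatives of the logarithmic cutoff, off the two circles where it has corners. -/
theorem lineDeriv_logCutoff_norm {E : Type*} [NormedAddCommGroup E] [InnerProductSpace ℝ E]
    {R : ℝ} (hR : 1 < R) {x : E} (h1 : ‖x‖ ≠ R) (h2 : ‖x‖ ≠ R ^ 2) (v : E) :
    lineDeriv ℝ (fun y : E => logCutoff R ‖y‖) x v =
      if R < ‖x‖ ∧ ‖x‖ < R ^ 2 then -(inner ℝ x v / (‖x‖ ^ 2 * Real.log R)) else 0 := by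
  have hc : Continuous fun y : E => ‖y‖ := continuous_norm
  rcases lt_or_gt_of_ne h1 with h | h
  · rw [if_neg (by intro hh; linarith [hh.1])]
    have : (fun y : E => logCutoff R ‖y‖) =ᶠ[nhds x] fun _ => 1 := by
      filter_upwards [hc.continuousAt.eventually (Iio_mem_nhds h)] with y hy
      exact logCutoff_of_le hR (le_of_lt hy)
    rw [this.lineDeriv_eq]
    simp [lineDeriv]
  rcases lt_or_gt_of_ne h2 with h' | h'
  · rw [if_pos ⟨h, h'⟩]
    have hx : 0 < ‖x‖ := by linarith
    have h3 : (fun y : E => logCutoff R ‖y‖) =ᶠ[nhds x]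
        fun y => 2 - (2 * Real.log R)⁻¹ * Real.log (‖y‖ ^ 2) := by
      filter_upwards [hc.continuousAt.eventually (Ioi_mem_nhds h),
        hc.continuousAt.eventually (Iio_mem_nhds h')] with y hy hy'
      rw [logCutoff_of_mem hR (le_of_lt hy) (le_of_lt hy'), Real.log_pow]
      push_cast
      field_simp
    have h4 := (((hasStrictFDerivAt_norm_sq x).hasFDerivAt.log (by positivity)).const_mul
      (2 * Real.log R)⁻¹).const_sub 2
    rw [h3.lineDeriv_eq, h4.differentiableAt.lineDeriv_eq_fderiv, h4.fderiv]
    simp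
    field_simp
  · rw [if_neg (by intro hh; linarith [hh.2])]
    have : (fun y : E => logCutoff R ‖y‖) =ᶠ[nhds x] fun _ => 0 := by
      filter_upwards [hc.continuousAt.eventually (Ioi_mem_nhds h')] with y hy
      exact logCutoff_of_ge hR (le_of_lt hy)
    rw [this.lineDeriv_eq]
    simp [lineDeriv]

/-- Integration by parts of a `C¹` vector field against a Lipschitz cutoff. -/
theorem integral_lipschitz_mul_fderiv {E : Type*} [NormedAddCommGroup E] [NormedSpace ℝ E]
    [FiniteDimensional ℝ E] [MeasurableSpace E] [BorelSpace E] {μ : Measure E}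
    [μ.IsAddHaarMeasure] {C : NNReal} {g f : E → ℝ} (hg : LipschitzWith C g)
    (hgc : HasCompactSupport g) (hf : ContDiff ℝ 1 f) (v : E) :
    Integrable (fun x => lineDeriv ℝ g x v * f x) μ ∧
      ∫ x, fderiv ℝ f x v * g x ∂μ = -∫ x, lineDeriv ℝ g x v * f x ∂μ := by
  obtain ⟨r, hr0, hr⟩ : ∃ r, 0 < r ∧ tsupport g ⊆ Metric.ball (0 : E) r :=
    hgc.isBounded.subset_ball_lt 0 0
  have hg0 : ∀ x, x ∉ Metric.ball (0 : E) r → g =ᶠ[nhds x] 0 := fun x hx =>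
    notMem_tsupport_iff_eventuallyEq.1 fun h => hx (hr h)
  let φ : ContDiffBump (0 : E) := ⟨r, r + 1, hr0, by linarith⟩
  have hφ : ∀ x ∈ Metric.ball (0 : E) r, φ x = 1 := fun x hx =>
    φ.one_of_mem_closedBall (Metric.ball_subset_closedBall hx)
  set F : E → ℝ := fun x => φ x * f x with hF
  have hFd : ContDiff ℝ 1 F := φ.contDiff.mul hf
  have hFc : HasCompactSupport F := φ.hasCompactSupport.mul_right
  obtain ⟨D, hD⟩ := hFd.lipschitzWith_of_hasCompactSupport hFc one_ne_zero
  have h1 : ∀ x, lineDeriv ℝ g x v * F x = lineDeriv ℝ g x v * f x := fun x => by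
    by_cases hx : x ∈ Metric.ball (0 : E) r
    · simp [hF, hφ x hx]
    · rw [(hg0 x hx).lineDeriv_eq]
      simp [lineDeriv]
  have h2 : ∀ x, lineDeriv ℝ F x v * g x = fderiv ℝ f x v * g x := fun x => by
    by_cases hx : x ∈ Metric.ball (0 : E) r
    · have : F =ᶠ[nhds x] f := by
        filter_upwards [Metric.isOpen_ball.mem_nhds hx] with y hy
        simp [hF, hφ y hy]
      rw [this.lineDeriv_eq, (hf.differentiable one_ne_zero x).lineDeriv_eq_fderiv]
    · rw [(hg0 x hx).eq_of_nhds]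
      simp
  refine ⟨?_, ?_⟩
  · have := (hFd.continuous.integrable_of_hasCompactSupport (μ := μ) hFc).bdd_mul
      (aestronglyMeasurable_lineDeriv (𝕜 := ℝ) (v := v) hg.continuous μ)
      (.of_forall fun x => norm_lineDeriv_le_of_lipschitz ℝ hg)
    simpa only [h1] using this
  · have := hD.integral_lineDeriv_mul_eq (μ := μ) hg hgc v
    simpa only [h2, lineDeriv_neg, neg_mul, h1, integral_neg] using this

/-- The modulus of the gradient of the logarithmic cutoff. -/
def logCutoffSlope (R r : ℝ) : ℝ := (Set.Ioo R (R ^ 2)).indicator (fun r => 1 / (r * Real.log R)) r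

theorem logCutoffSlope_nonneg {R r : ℝ} (hR : 1 < R) : 0 ≤ logCutoffSlope R r := by
  refine Set.indicator_nonneg (fun r hr => ?_) r
  have := Real.log_pos hR
  have : 0 < r := by linarith [hr.1]
  positivity

theorem measurable_logCutoffSlope (R : ℝ) : Measurable (logCutoffSlope R) :=
  (measurable_const.div (measurable_id.mul_const _)).indicator measurableSet_Ioo

/-- The Dirichlet integral of the logarithmic cutoff of the plane. -/
theorem integral_logCutoffSlope_sq {R : ℝ} (hR : 1 < R) :
    Integrable (fun x : Plane => logCutoffSlope R ‖x‖ ^ 2) ∧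
      ∫ x : Plane, logCutoffSlope R ‖x‖ ^ 2 = 2 * Real.pi / Real.log R := by
  have hl := Real.log_pos hR
  have hRR : R ≤ R ^ 2 := by nlinarith
  have hfr : Module.finrank ℝ Plane = 2 := by simp
  have hpt : ∀ y : ℝ, y ^ (2 - 1) • logCutoffSlope R y ^ 2 =
      (Set.Ioo R (R ^ 2)).indicator (fun r => r⁻¹ * (Real.log R ^ 2)⁻¹) y := fun y => by
    by_cases hy : y ∈ Set.Ioo R (R ^ 2)
    · have : y ≠ 0 := by linarith [hy.1]
      rw [logCutoffSlope, Set.indicator_of_mem hy, Set.indicator_of_mem hy, smul_eq_mul, Nat.add_one_sub_one, pow_one]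
      field_simp
    · rw [logCutoffSlope, Set.indicator_of_notMem hy, Set.indicator_of_notMem hy]
      simp
  have hsub : Set.Ioo R (R ^ 2) ⊆ Set.Ioi 0 := fun y hy => by
    have := hy.1
    exact Set.mem_Ioi.2 (by linarith)
  have hint : IntervalIntegrable (fun r : ℝ => r⁻¹ * (Real.log R ^ 2)⁻¹) volume R (R ^ 2) := by
    refine ContinuousOn.intervalIntegrable fun r hr => ?_
    rw [Set.uIcc_of_le hRR] at hr
    have : r ≠ 0 := by linarith [hr.1]
    exact ((continuousAt_inv₀ this).mul continuousAt_const).continuousWithinAt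
  refine ⟨?_, ?_⟩
  · rw [integrable_fun_norm_addHaar (volume : Measure Plane) (f := fun r => logCutoffSlope R r ^ 2),
      hfr]
    simp only [hpt]
    rw [integrableOn_indicator_iff measurableSet_Ioo, Set.inter_eq_left.2 hsub]
    rw [← intervalIntegrable_iff_integrableOn_Ioo_of_le hRR]
    exact hint
  · rw [integral_fun_norm_addHaar (volume : Measure Plane) (fun r => logCutoffSlope R r ^ 2), hfr]
    simp only [hpt]
    rw [setIntegral_indicator measurableSet_Ioo, Set.inter_eq_right.2 hsub,
      ← integral_Ioc_eq_integral_Ioo, ← intervalIntegral.integral_of_le hRR,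
      intervalIntegral.integral_mul_const, integral_inv_of_pos (by linarith) (by positivity),
      measureReal_def, EuclideanSpace.volume_ball_fin_two]
    have : R ^ 2 / R = R := by field_simp
    rw [this]
    simp [Real.pi_pos.le]
    field_simp

/-- Logarithmic cutoff estimate: a planar `C¹` field with nonnegative divergence and square
integrable size has flux of order `(log R)^(-1/2)`. -/
theorem setIntegral_divergence_le (X : Fin 2 → Plane → ℝ) (hX : ∀ i, ContDiff ℝ 1 (X i))
    (hdiv : ∀ x, 0 ≤ ∑ i, fderiv ℝ (X i) x (EuclideanSpace.single i 1))
    {P : Plane → ℝ} (hP : Integrable P) (hP0 : ∀ x, 0 ≤ P x) {K : ℝ} (hK : 0 ≤ K)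
    (hXP : ∀ x, ∑ i, X i x ^ 2 ≤ K ^ 2 * P x) {R : ℝ} (hR : 1 < R) :
    ∫ x in Metric.ball (0 : Plane) R, ∑ i, fderiv ℝ (X i) x (EuclideanSpace.single i 1) ≤
      K * √(2 * Real.pi * (∫ x, P x) / Real.log R) := by
  have hl := Real.log_pos hR
  obtain ⟨C, hC⟩ := logCutoff_norm_lipschitz (E := Plane) hR
  have hηc := hasCompactSupport_logCutoff_norm (E := Plane) hR
  set η : Plane → ℝ := fun x => logCutoff R ‖x‖ with hη
  set Q : Plane → ℝ := fun x => ∑ i, fderiv ℝ (X i) x (EuclideanSpace.single i 1) with hQ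
  have hdc : ∀ i, Continuous fun x => fderiv ℝ (X i) x (EuclideanSpace.single i (1 : ℝ)) :=
    fun i => ((hX i).continuous_fderiv one_ne_zero).clm_apply continuous_const
  have hQc : Continuous Q := continuous_finsetSum _ fun i _ => hdc i
  have hIBP := fun i => integral_lipschitz_mul_fderiv (μ := (volume : Measure Plane)) hC hηc
    (hX i) (EuclideanSpace.single i 1)
  have hQη : Integrable fun x => Q x * η x :=
    (hQc.mul hC.continuous).integrable_of_hasCompactSupport hηc.mul_left
  have h1 : ∫ x in Metric.ball (0 : Plane) R, Q x ≤ ∫ x, Q x * η x := by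
    calc ∫ x in Metric.ball (0 : Plane) R, Q x
        = ∫ x in Metric.ball (0 : Plane) R, Q x * η x := by
          refine setIntegral_congr_fun Metric.isOpen_ball.measurableSet fun x hx => ?_
          have : ‖x‖ ≤ R := (mem_ball_zero_iff.1 hx).le
          simp [hη, logCutoff_of_le hR this]
      _ ≤ ∫ x, Q x * η x := setIntegral_le_integral hQη
          (.of_forall fun x => mul_nonneg (hdiv x) (logCutoff_nonneg _ _))
  have h2 : ∫ x, Q x * η x =
      -∫ x, ∑ i, lineDeriv ℝ η x (EuclideanSpace.single i 1) * X i x := by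
    rw [integral_finsetSum _ fun i _ => (hIBP i).1, ← Finset.sum_neg_distrib]
    simp only [hQ, Finset.sum_mul]
    have hint : ∀ i, Integrable fun x =>
        fderiv ℝ (X i) x (EuclideanSpace.single i (1 : ℝ)) * η x := fun i =>
      ((hdc i).mul hC.continuous).integrable_of_hasCompactSupport hηc.mul_left
    rw [integral_finsetSum _ fun i _ => hint i]
    exact Finset.sum_congr rfl fun i _ => (hIBP i).2
  obtain ⟨hwi, hw⟩ := integral_logCutoffSlope_sq hR
  have hwm : AEStronglyMeasurable fun x : Plane => logCutoffSlope R ‖x‖ :=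
    ((measurable_logCutoffSlope R).comp measurable_norm).aestronglyMeasurable
  have hPm : AEStronglyMeasurable fun x => √(P x) :=
    Real.continuous_sqrt.comp_aestronglyMeasurable hP.aestronglyMeasurable
  have hw2 : MemLp (fun x : Plane => logCutoffSlope R ‖x‖) 2 :=
    (memLp_two_iff_integrable_sq hwm).2 hwi
  have hP2 : MemLp (fun x => √(P x)) 2 := by
    refine (memLp_two_iff_integrable_sq hPm).2 ?_
    simpa only [Real.sq_sqrt (hP0 _)] using hP
  have hsph : ∀ r : ℝ, ∀ᵐ x : Plane, ‖x‖ ≠ r := fun r => by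
    have : volume (Metric.sphere (0 : Plane) r) = 0 := Measure.addHaar_sphere _ _ _
    filter_upwards [measure_eq_zero_iff_ae_notMem.1 this] with x hx h
    exact hx (by simpa using h)
  have h3 : ‖∫ x, ∑ i, lineDeriv ℝ η x (EuclideanSpace.single i 1) * X i x‖ ≤
      ∫ x, K * (logCutoffSlope R ‖x‖ * √(P x)) := by
    refine norm_integral_le_of_norm_le ((hw2.integrable_mul hP2).const_mul K) ?_
    filter_upwards [hsph R, hsph (R ^ 2)] with x hx1 hx2
    simp only [hη, lineDeriv_logCutoff_norm hR hx1 hx2]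
    by_cases hx : R < ‖x‖ ∧ ‖x‖ < R ^ 2
    · have hx0 : 0 < ‖x‖ := by linarith [hx.1]
      have hcs : |∑ i, x i * X i x| ≤ ‖x‖ * (K * √(P x)) := by
        refine abs_le_of_sq_le_sq ?_ (by positivity)
        calc (∑ i, x i * X i x) ^ 2 ≤ (∑ i, x i ^ 2) * ∑ i, X i x ^ 2 :=
              Finset.sum_mul_sq_le_sq_mul_sq _ _ _
          _ ≤ ‖x‖ ^ 2 * (K ^ 2 * P x) := by
              rw [EuclideanSpace.real_norm_sq_eq]
              exact mul_le_mul_of_nonneg_left (hXP x) (Finset.sum_nonneg fun i _ => sq_nonneg _)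
          _ = (‖x‖ * (K * √(P x))) ^ 2 := by
              rw [mul_pow, mul_pow, Real.sq_sqrt (hP0 x)]
      have he : ∑ i, (if R < ‖x‖ ∧ ‖x‖ < R ^ 2 then
          -(inner ℝ x (EuclideanSpace.single i (1 : ℝ)) / (‖x‖ ^ 2 * Real.log R)) else 0) * X i x =
          -((∑ i, x i * X i x) / (‖x‖ ^ 2 * Real.log R)) := by
        rw [Finset.sum_div, ← Finset.sum_neg_distrib]
        refine Finset.sum_congr rfl fun i _ => ?_
        rw [if_pos hx, EuclideanSpace.inner_single_right]
        simp
        ring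
      rw [he, norm_neg, Real.norm_eq_abs, abs_div, abs_of_pos (a := ‖x‖ ^ 2 * _) (by positivity),
        logCutoffSlope, Set.indicator_of_mem (Set.mem_Ioo.2 hx), div_le_iff₀ (by positivity)]
      refine hcs.trans_eq ?_
      field_simp
    · simp only [if_neg hx, zero_mul, Finset.sum_const_zero, norm_zero]
      exact mul_nonneg hK (mul_nonneg (logCutoffSlope_nonneg hR) (Real.sqrt_nonneg _))
  have h4 : ∫ x, logCutoffSlope R ‖x‖ * √(P x) ≤ √(2 * Real.pi * (∫ x, P x) / Real.log R) := by
    have h := integral_mul_le_Lp_mul_Lq_of_nonneg (μ := (volume : Measure Plane))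
      (Real.HolderConjugate.two_two) (f := fun x => logCutoffSlope R ‖x‖) (g := fun x => √(P x))
      (.of_forall fun x => logCutoffSlope_nonneg hR) (.of_forall fun x => Real.sqrt_nonneg _)
      (by simpa using hw2) (by simpa using hP2)
    simp only [Real.rpow_two, Real.sq_sqrt (hP0 _), hw, ← Real.sqrt_eq_rpow] at h
    rw [← Real.sqrt_mul (by positivity)] at h
    refine h.trans_eq ?_
    congr 1
    ring
  calc ∫ x in Metric.ball (0 : Plane) R, Q x
      ≤ ‖∫ x, ∑ i, lineDeriv ℝ η x (EuclideanSpace.single i 1) * X i x‖ := by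
        refine (h1.trans_eq h2).trans ?_
        rw [Real.norm_eq_abs]
        exact neg_le_abs _
    _ ≤ K * ∫ x, logCutoffSlope R ‖x‖ * √(P x) := by
        rw [← integral_const_mul]
        exact h3
    _ ≤ _ := mul_le_mul_of_nonneg_left h4 hK

theorem cross_zero_apply (a b : V3) : cross a b 0 = a 1 * b 2 - a 2 * b 1 := rfl

theorem cross_one_apply (a b : V3) : cross a b 1 = a 2 * b 0 - a 0 * b 2 := rfl

theorem cross_two_apply (a b : V3) : cross a b 2 = a 0 * b 1 - a 1 * b 0 := rfl

theorem inner_V3 (a b : V3) : inner ℝ a b = a 0 * b 0 + a 1 * b 1 + a 2 * b 2 := by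
  simp [PiLp.inner_apply, Fin.sum_univ_three]
  ring

theorem inner_cross_right_self (a b : V3) : inner ℝ (cross a b) b = 0 := by
  simp only [inner_V3, cross_zero_apply, cross_one_apply, cross_two_apply]
  ring

theorem inner_cross_left_comm (a b c : V3) :
    inner ℝ (cross a b) c = -inner ℝ (cross a c) b := by
  simp only [inner_V3, cross_zero_apply, cross_one_apply, cross_two_apply]
  ring

theorem inner_cross_cross_self (a b : V3) : inner ℝ (cross b (cross a b)) a = ‖cross a b‖ ^ 2 := by
  simp only [← real_inner_self_eq_norm_sq, inner_V3, cross_zero_apply, cross_one_apply,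
    cross_two_apply]
  ring

theorem ContDiff.cross {E : Type*} [NormedAddCommGroup E] [NormedSpace ℝ E] {n : WithTop ℕ∞}
    {f g : E → V3} (hf : ContDiff ℝ n f) (hg : ContDiff ℝ n g) :
    ContDiff ℝ n fun x => cross (f x) (g x) := by
  rw [contDiff_euclidean] at *
  intro i
  fin_cases i
  · exact ((hf 1).mul (hg 2)).sub ((hf 2).mul (hg 1))
  · exact ((hf 2).mul (hg 0)).sub ((hf 0).mul (hg 2))
  · exact ((hf 0).mul (hg 1)).sub ((hf 1).mul (hg 0))

theorem fderiv_inner_single {f g : Plane → V3} {x : Plane} (hf : DifferentiableAt ℝ f x)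
    (hg : DifferentiableAt ℝ g x) (i : Fin 2) :
    fderiv ℝ (fun y => inner ℝ (f y) (g y)) x (EuclideanSpace.single i 1) =
      inner ℝ (pd i f x) (g x) + inner ℝ (f x) (pd i g x) := by
  rw [fderiv_inner_apply ℝ hf hg, add_comm]
  rfl

theorem ContDiff.pd {f : Plane → V3} (hf : ContDiff ℝ 2 f) (i : Fin 2) :
    ContDiff ℝ 1 (pd i f) :=
  (hf.fderiv_right (m := 1) (by norm_num)).clm_apply contDiff_const

/-- Half the Laplacian of `|A₀|²` equals the energy density when `A₀` solves the Gauss law. -/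
theorem gauss_law_inner_self {A : Fin 2 → Plane → V3} {Φ A₀ : Plane → V3}
    (hA : ∀ i, ContDiff ℝ 1 (A i)) (hA₀ : ContDiff ℝ 2 A₀) {x : Plane}
    (heq : lap A₀ x
        + ∑ i, (pd i (fun y => cross (A i y) (A₀ y)) x
            + cross (A i x) (pd i A₀ x)
            + cross (A i x) (cross (A i x) (A₀ x)))
        - cross (Φ x) (cross (A₀ x) (Φ x)) = 0) :
    ∑ i, (inner ℝ (pd i (pd i A₀) x) (A₀ x) + ‖pd i A₀ x‖ ^ 2) =
      (∑ i, ‖pd i A₀ x + cross (A i x) (A₀ x)‖ ^ 2) + ‖cross (A₀ x) (Φ x)‖ ^ 2 := by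
  have hA₀1 : ContDiff ℝ 1 A₀ := hA₀.of_le (by norm_num)
  have hd : ∀ i, inner ℝ (pd i (fun y => cross (A i y) (A₀ y)) x) (A₀ x) =
      -inner ℝ (cross (A i x) (A₀ x)) (pd i A₀ x) := fun i => by
    have h := fderiv_inner_single (((hA i).cross hA₀1).differentiable one_ne_zero x)
      (hA₀1.differentiable one_ne_zero x) i
    simp only [inner_cross_right_self, fderiv_fun_const, Pi.zero_apply,
      zero_apply] at h
    linarith
  have h := congrArg (fun w => inner ℝ w (A₀ x)) heq
  simp only [lap, Fin.sum_univ_two, inner_sub_left, inner_add_left, inner_zero_left, hd,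
    inner_cross_cross_self] at h
  simp only [Fin.sum_univ_two, norm_add_sq_real]
  have h1 : ∀ i, inner ℝ (cross (A i x) (pd i A₀ x)) (A₀ x) =
      -inner ℝ (pd i A₀ x) (cross (A i x) (A₀ x)) := fun i => by
    rw [inner_cross_left_comm, real_inner_comm]
  have h2 : ∀ i, inner ℝ (cross (A i x) (cross (A i x) (A₀ x))) (A₀ x) =
      -‖cross (A i x) (A₀ x)‖ ^ 2 := fun i => by
    rw [inner_cross_left_comm, real_inner_self_eq_norm_sq]
  have h3 : ∀ i, inner ℝ (cross (A i x) (A₀ x)) (pd i A₀ x) =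
      inner ℝ (pd i A₀ x) (cross (A i x) (A₀ x)) := fun i => real_inner_comm _ _
  simp only [h1, h2, h3] at h
  linarith

/-- The Kato-type inequality for the covariant derivative. -/
theorem inner_sq_le_norm_add_cross_sq (a b p : V3) :
    inner ℝ p a ^ 2 ≤ ‖a‖ ^ 2 * ‖p + cross b a‖ ^ 2 := by
  have h1 : inner ℝ p a = inner ℝ (p + cross b a) a := by
    rw [inner_add_left, inner_cross_right_self, add_zero]
  have h2 := abs_real_inner_le_norm (p + cross b a) a
  rw [h1, ← sq_abs, ← mul_pow, mul_comm ‖a‖]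
  gcongr

theorem nonabelian_julia_zee_cutoff_estimate
    (A : Fin 2 → Plane → V3) (Φ A₀ : Plane → V3)
    (hA : ∀ i, ContDiff ℝ 1 (A i)) (hΦ : ContDiff ℝ 1 Φ) (hA₀ : ContDiff ℝ 2 A₀)
    -- the static non-Abelian Gauss law
    (heq : ∀ x, lap A₀ x
        + ∑ i, (pd i (fun y => cross (A i y) (A₀ y)) x
            + cross (A i x) (pd i A₀ x)
            + cross (A i x) (cross (A i x) (A₀ x)))
        - cross (Φ x) (cross (A₀ x) (Φ x)) = 0)
    -- finite electric energy E(A₀)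
    (hfin : Integrable (fun x =>
        (1 / 2) * ∑ i, ‖pd i A₀ x + cross (A i x) (A₀ x)‖ ^ 2
        + (1 / 2) * ‖cross (A₀ x) (Φ x)‖ ^ 2))
    (M R : ℝ) (hM : 0 < M) (hR : 1 < R) :
    (∫ x in {x : Plane | ‖A₀ x‖ ≤ M} ∩ Metric.ball (0 : Plane) R,
        ((∑ i, ‖pd i A₀ x + cross (A i x) (A₀ x)‖ ^ 2)
          + ‖cross (A₀ x) (Φ x)‖ ^ 2))
      ≤ M * Real.sqrt (4 * Real.pi *
          (∫ x, ((1 / 2) * ∑ i, ‖pd i A₀ x + cross (A i x) (A₀ x)‖ ^ 2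
            + (1 / 2) * ‖cross (A₀ x) (Φ x)‖ ^ 2)) / Real.log R) := by
  have hA₀1 : ContDiff ℝ 1 A₀ := hA₀.of_le (by norm_num)
  set N : Plane → ℝ := fun x =>
    (∑ i, ‖pd i A₀ x + cross (A i x) (A₀ x)‖ ^ 2) + ‖cross (A₀ x) (Φ x)‖ ^ 2 with hN
  have hNE : (fun x => (1 / 2) * ∑ i, ‖pd i A₀ x + cross (A i x) (A₀ x)‖ ^ 2
      + (1 / 2) * ‖cross (A₀ x) (Φ x)‖ ^ 2) = fun x => (1 / 2) * N x := by
    funext x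
    simp only [hN]
    ring
  have hN0 : ∀ x, 0 ≤ N x := fun x => by positivity
  rw [hNE] at hfin
  rw [hNE, integral_const_mul]
  have hNi : Integrable N := by simpa using hfin.const_mul 2
  set S : Set Plane := {x : Plane | ‖A₀ x‖ ≤ M} with hS
  have hSm : MeasurableSet S := (isClosed_le hA₀.continuous.norm continuous_const).measurableSet
  have key : ∀ K, M < K → ∫ x in S ∩ Metric.ball (0 : Plane) R, N x ≤
      K * √(2 * Real.pi * (∫ x, N x) / Real.log R) := by
    intro K hK
    obtain ⟨F, F', hFd, hF'c, hF1, hF⟩ := exists_truncation_factor (m := M ^ 2)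
      (δ := K ^ 2 - M ^ 2) (by positivity) (by nlinarith)
    have hFc : ContDiff ℝ 1 F := by
      rw [contDiff_one_iff_deriv]
      refine ⟨fun t => (hFd t).differentiableAt, ?_⟩
      rwa [funext fun t => (hFd t).deriv]
    set X : Fin 2 → Plane → ℝ := fun i x =>
      F (inner ℝ (A₀ x) (A₀ x)) * inner ℝ (pd i A₀ x) (A₀ x) with hXdef
    have hX : ∀ i, ContDiff ℝ 1 (X i) := fun i =>
      (hFc.comp (hA₀1.inner ℝ hA₀1)).mul ((hA₀.pd i).inner ℝ hA₀1)
    have hdX : ∀ i x, fderiv ℝ (X i) x (EuclideanSpace.single i 1) =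
        2 * F' (‖A₀ x‖ ^ 2) * inner ℝ (pd i A₀ x) (A₀ x) ^ 2 +
        F (‖A₀ x‖ ^ 2) * (inner ℝ (pd i (pd i A₀) x) (A₀ x) + ‖pd i A₀ x‖ ^ 2) := by
      intro i x
      have d0 := hA₀1.differentiable one_ne_zero x
      have d1 := (hA₀.pd i).differentiable one_ne_zero x
      have e1 := (hFd (inner ℝ (A₀ x) (A₀ x))).comp_hasFDerivAt x (d0.inner ℝ d0).hasFDerivAt
      have e2 := e1.mul (d1.inner ℝ d0).hasFDerivAt
      have e3 : fderiv ℝ (X i) x = _ := e2.fderiv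
      rw [e3]
      simp only [add_apply, smul_apply, smul_eq_mul, fderiv_inner_single d0 d0,
        fderiv_inner_single d1 d0, Function.comp_apply]
      simp only [real_inner_self_eq_norm_sq, real_inner_comm (pd i A₀ x) (A₀ x)]
      ring
    have hdiv : ∀ x, ∑ i, fderiv ℝ (X i) x (EuclideanSpace.single i 1) =
        2 * F' (‖A₀ x‖ ^ 2) * (∑ i, inner ℝ (pd i A₀ x) (A₀ x) ^ 2) + F (‖A₀ x‖ ^ 2) * N x := by
      intro x
      simp only [hdX, hN, ← gauss_law_inner_self hA hA₀ (heq x), Finset.sum_add_distrib,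
        Finset.mul_sum, mul_add]
    have hkato : ∀ x, ∑ i, inner ℝ (pd i A₀ x) (A₀ x) ^ 2 ≤
        ‖A₀ x‖ ^ 2 * ∑ i, ‖pd i A₀ x + cross (A i x) (A₀ x)‖ ^ 2 := fun x => by
      rw [Finset.mul_sum]
      exact Finset.sum_le_sum fun i _ => inner_sq_le_norm_add_cross_sq _ _ _
    have hdiv0 : ∀ x, 0 ≤ ∑ i, fderiv ℝ (X i) x (EuclideanSpace.single i 1) := by
      intro x
      obtain ⟨f1, f2, f3, -⟩ := hF (‖A₀ x‖ ^ 2) (by positivity)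
      have hD : 0 ≤ ∑ i, ‖pd i A₀ x + cross (A i x) (A₀ x)‖ ^ 2 := by positivity
      rw [hdiv]
      simp only [hN]
      have g1 := mul_le_mul_of_nonpos_left (hkato x) f2
      have g2 := mul_nonneg f3 hD
      have g3 := mul_nonneg f1 (sq_nonneg ‖cross (A₀ x) (Φ x)‖)
      linarith
    have hXN : ∀ x, ∑ i, X i x ^ 2 ≤ K ^ 2 * N x := by
      intro x
      obtain ⟨-, -, -, f4⟩ := hF (‖A₀ x‖ ^ 2) (by positivity)
      have hD : 0 ≤ ∑ i, ‖pd i A₀ x + cross (A i x) (A₀ x)‖ ^ 2 := by positivity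
      calc ∑ i, X i x ^ 2
          = F (‖A₀ x‖ ^ 2) ^ 2 * ∑ i, inner ℝ (pd i A₀ x) (A₀ x) ^ 2 := by
            simp only [hXdef, real_inner_self_eq_norm_sq, mul_pow, Finset.mul_sum]
        _ ≤ F (‖A₀ x‖ ^ 2) ^ 2 * (‖A₀ x‖ ^ 2 *
              ∑ i, ‖pd i A₀ x + cross (A i x) (A₀ x)‖ ^ 2) := by
            gcongr
            exact hkato x
        _ = (‖A₀ x‖ ^ 2 * F (‖A₀ x‖ ^ 2) ^ 2) *
              ∑ i, ‖pd i A₀ x + cross (A i x) (A₀ x)‖ ^ 2 := by ring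
        _ ≤ K ^ 2 * ∑ i, ‖pd i A₀ x + cross (A i x) (A₀ x)‖ ^ 2 := by
            gcongr
            linarith
        _ ≤ K ^ 2 * N x := by
            gcongr
            simp only [hN]
            linarith [sq_nonneg ‖cross (A₀ x) (Φ x)‖]
    have hcont : Continuous fun x => ∑ i, fderiv ℝ (X i) x (EuclideanSpace.single i (1 : ℝ)) :=
      continuous_finsetSum _ fun i _ =>
        ((hX i).continuous_fderiv one_ne_zero).clm_apply continuous_const
    calc ∫ x in S ∩ Metric.ball (0 : Plane) R, N x
        = ∫ x in S ∩ Metric.ball (0 : Plane) R,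
            ∑ i, fderiv ℝ (X i) x (EuclideanSpace.single i 1) := by
          refine setIntegral_congr_fun (hSm.inter Metric.isOpen_ball.measurableSet) fun x hx => ?_
          have hx' : ‖A₀ x‖ ≤ M := hx.1
          obtain ⟨g1, g2⟩ := hF1 (‖A₀ x‖ ^ 2) (by gcongr)
          simp only [hdiv, g1, g2]
          ring
      _ ≤ ∫ x in Metric.ball (0 : Plane) R,
            ∑ i, fderiv ℝ (X i) x (EuclideanSpace.single i 1) :=
          setIntegral_mono_set
            ((hcont.continuousOn.integrableOn_compact (isCompact_closedBall 0 R)).mono_set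
              Metric.ball_subset_closedBall)
            (.of_forall hdiv0) (.of_forall fun x hx => hx.2)
      _ ≤ K * √(2 * Real.pi * (∫ x, N x) / Real.log R) :=
          setIntegral_divergence_le X hX hdiv0 hNi hN0 (by linarith) hXN hR
  have hsqrt : 4 * Real.pi * (1 / 2 * ∫ x, N x) = 2 * Real.pi * ∫ x, N x := by ring
  rw [hsqrt]
  have hlim : Filter.Tendsto (fun K => K * √(2 * Real.pi * (∫ x, N x) / Real.log R))
      (nhdsWithin M (Set.Ioi M)) (nhds (M * √(2 * Real.pi * (∫ x, N x) / Real.log R))) :=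
    (continuous_id.mul continuous_const).continuousWithinAt
  refine ge_of_tendsto hlim ?_
  filter_upwards [self_mem_nhdsWithin] with K hK using key K hK

end
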